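/- arXiv:2111.15431 — 2 statements merged into one kernel-verified Lean document; each statement's English description precedes it below -/
import Mathlib

section
/- For a binary ICA model, in any given segment u the correlation matrix of the covariance Σ_q^u of the associated Gaussian vector q^u is identifiable from the probability distribution of the binary observation vector x^u: if two binary ICA models induce the same distribution on x^u ∈ {0,1}^n in segment u, then the correlation matrices of their covariances Σ_q^u and Σ̂_q^u are equal. -/
open MeasureTheory Matrix Real

/-- Multivariate Gaussian measure on `Fin n → ℝ` with mean `μ` and (positive-definite)
covariance `S`, defined via its density w.r.t. Lebesgue measure. -/
noncomputable def mvGaussian {n : ℕ} (μ : Fin n → ℝ) (S : Matrix (Fin n) (Fin n) ℝ) :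
    Measure (Fin n → ℝ) :=
  volume.withDensity fun x =>
    ENNReal.ofReal (Real.sqrt (((2 * Real.pi) ^ n * S.det)⁻¹) *
      Real.exp (-(1 / 2) * ((x - μ) ⬝ᵥ (S⁻¹ *ᵥ (x - μ)))))

/-- The orthant of `ℝ^n` corresponding to a binary assignment `b`:
coordinates with `b i = 1` are negative, the others positive. -/
def orthant {n : ℕ} (b : Fin n → Bool) : Set (Fin n → ℝ) :=
  {w | ∀ i, if b i then w i < 0 else 0 < w i}

/-- `μ_q = -√(π/8) A μ_z`. -/
noncomputable def muQ {n nz : ℕ} (A : Matrix (Fin n) (Fin nz) ℝ) (μz : Fin nz → ℝ) :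
    Fin n → ℝ :=
  (-Real.sqrt (Real.pi / 8)) • (A *ᵥ μz)

/-- `Σ_q = I + (π/8) A Σ_z Aᵀ`. -/
noncomputable def sigmaQ {n nz : ℕ} (A : Matrix (Fin n) (Fin nz) ℝ)
    (Sz : Matrix (Fin nz) (Fin nz) ℝ) : Matrix (Fin n) (Fin n) ℝ :=
  1 + (Real.pi / 8) • (A * Sz * Aᵀ)

/-- The probability that the binary ICA model with mixing matrix `A`, source means `μz`
and source covariance `Sz` assigns to the binary observation `b`: the probability of the
corresponding orthant under the Gaussian `N(μ_q, Σ_q)`. -/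
noncomputable def binProb {n nz : ℕ} (A : Matrix (Fin n) (Fin nz) ℝ) (μz : Fin nz → ℝ)
    (Sz : Matrix (Fin nz) (Fin nz) ℝ) (b : Fin n → Bool) : ENNReal :=
  mvGaussian (muQ A μz) (sigmaQ A Sz) (orthant b)

/-- Correlation matrix of a covariance matrix. -/
noncomputable def corrMat {n : ℕ} (S : Matrix (Fin n) (Fin n) ℝ) :
    Matrix (Fin n) (Fin n) ℝ :=
  Matrix.of fun i j => S i j / Real.sqrt (S i i * S j j)

/-- The standard normal cumulative distribution function. -/
noncomputable def stdNormalCDF (t : ℝ) : ℝ :=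
  ∫ s in Set.Iic t, (Real.sqrt (2 * Real.pi))⁻¹ * Real.exp (-(s ^ 2) / 2)

open ProbabilityTheory

/-- The product of standard Gaussians has density the product of the Gaussian densities. -/
lemma pi_gaussianReal_eq_withDensity {ι : Type*} [Fintype ι] :
    Measure.pi (fun _ : ι ↦ gaussianReal 0 1) =
      volume.withDensity fun z : ι → ℝ ↦ ENNReal.ofReal (∏ i, gaussianPDFReal 0 1 (z i)) := by
  refine Measure.pi_eq fun s hs ↦ ?_
  have hm : MeasurableSet (Set.univ.pi s) := MeasurableSet.univ_pi hs
  have hint (i : ι) : Integrable ((s i).indicator (gaussianPDFReal 0 1)) :=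
    (integrable_gaussianPDFReal 0 1).indicator (hs i)
  have hnn (i : ι) (x : ℝ) : 0 ≤ (s i).indicator (gaussianPDFReal 0 1) x :=
    Set.indicator_nonneg (fun y _ ↦ gaussianPDFReal_nonneg 0 1 y) x
  have hind (z : ι → ℝ) :
      (Set.univ.pi s).indicator
        (fun z ↦ ENNReal.ofReal (∏ i, gaussianPDFReal 0 1 (z i))) z =
      ENNReal.ofReal (∏ i, (s i).indicator (gaussianPDFReal 0 1) (z i)) := by
    by_cases hz : z ∈ Set.univ.pi s
    · rw [Set.indicator_of_mem hz]
      congr 1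
      exact Finset.prod_congr rfl fun i _ ↦ (Set.indicator_of_mem (hz i trivial) _).symm
    · rw [Set.indicator_of_notMem hz]
      obtain ⟨i, hi⟩ : ∃ i, z i ∉ s i := by simpa [Set.mem_pi] using hz
      rw [Finset.prod_eq_zero (Finset.mem_univ i) (Set.indicator_of_notMem hi _),
        ENNReal.ofReal_zero]
  rw [withDensity_apply _ hm, ← lintegral_indicator hm, lintegral_congr hind,
    ← ofReal_integral_eq_lintegral_ofReal]
  · rw [integral_fintype_prod_volume_eq_prod
      (fun i ↦ (s i).indicator (gaussianPDFReal 0 1)),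
      ENNReal.ofReal_prod_of_nonneg fun i _ ↦ integral_nonneg (hnn i)]
    refine Finset.prod_congr rfl fun i _ ↦ ?_
    rw [integral_indicator (hs i), gaussianReal_apply_eq_integral 0 one_ne_zero]
  · exact Integrable.fintype_prod hint
  · exact Filter.Eventually.of_forall fun z ↦ Finset.prod_nonneg fun i _ ↦ hnn i _

/-- `N(μ, B Bᵀ)` is the image of the standard Gaussian under `z ↦ μ + B z`. -/
lemma mvGaussian_eq_map_pi {n : ℕ} (μ : Fin n → ℝ) {S B : Matrix (Fin n) (Fin n) ℝ}
    (hB : B.det ≠ 0) (hS : B * Bᵀ = S) :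
    mvGaussian μ S =
      (Measure.pi fun _ : Fin n ↦ gaussianReal 0 1).map fun z ↦ μ + B *ᵥ z := by
  have hT : Measurable fun z : Fin n → ℝ ↦ μ + B *ᵥ z := by fun_prop
  have hvol : (volume : Measure (Fin n → ℝ)) =
      ENNReal.ofReal |B.det| • volume.map fun z ↦ μ + B *ᵥ z := by
    have h1 : (fun z : Fin n → ℝ ↦ μ + B *ᵥ z) = (fun x ↦ μ + x) ∘ toLin' B := by
      ext z; simp
    rw [h1, ← Measure.map_map (by fun_prop) (by fun_prop),
      Real.map_matrix_volume_pi_eq_smul_volume_pi hB, Measure.map_smul,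
      (measurePreserving_add_left volume μ).map_eq, smul_smul,
      ← ENNReal.ofReal_mul (abs_nonneg _), ← abs_mul, mul_inv_cancel₀ hB, abs_one,
      ENNReal.ofReal_one, one_smul]
  have hdetS : S.det = B.det ^ 2 := by rw [← hS, det_mul, det_transpose, sq]
  have hquad (z : Fin n → ℝ) : (B *ᵥ z) ⬝ᵥ (S⁻¹ *ᵥ (B *ᵥ z)) = ∑ i, z i ^ 2 := by
    have hu : IsUnit B.det := hB.isUnit
    have hut : IsUnit Bᵀ.det := by rwa [det_transpose]
    have hSB : S⁻¹ *ᵥ (B *ᵥ z) = (Bᵀ)⁻¹ *ᵥ z := by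
      rw [← hS, Matrix.mul_inv_rev, mulVec_mulVec, Matrix.mul_assoc, nonsing_inv_mul _ hu,
        Matrix.mul_one]
    rw [hSB, ← vecMul_transpose, ← dotProduct_mulVec, mulVec_mulVec, mul_nonsing_inv _ hut,
      one_mulVec, dotProduct]
    exact Finset.sum_congr rfl fun i _ ↦ (sq (z i)).symm
  have hconst : |B.det| * √(((2 * π) ^ n * S.det)⁻¹) = (√(2 * π))⁻¹ ^ n := by
    rw [hdetS, Real.sqrt_inv, Real.sqrt_mul (by positivity), Real.sqrt_sq_eq_abs, mul_inv]
    rw [mul_comm, mul_assoc, inv_mul_cancel₀ (abs_ne_zero.2 hB), mul_one, inv_pow]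
    congr 1
    rw [Real.sqrt_eq_iff_mul_self_eq (by positivity) (by positivity), ← mul_pow,
      Real.mul_self_sqrt (by positivity)]
  ext s hs
  rw [mvGaussian, withDensity_apply _ hs, Measure.map_apply hT hs,
    pi_gaussianReal_eq_withDensity, withDensity_apply _ (hT hs)]
  conv_lhs => rw [hvol]
  rw [Measure.restrict_smul,
    lintegral_smul_measure, setLIntegral_map hs (by fun_prop) hT, smul_eq_mul,
    ← lintegral_const_mul _ (by fun_prop)]
  refine lintegral_congr fun z ↦ ?_
  rw [← ENNReal.ofReal_mul (abs_nonneg _), add_sub_cancel_left, hquad, ← mul_assoc, hconst]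
  congr 1
  simp only [gaussianPDFReal, Finset.prod_mul_distrib, ← Real.exp_sum]
  simp only [NNReal.coe_one, mul_one, sub_zero, Finset.prod_const, Finset.card_univ,
    Fintype.card_fin, ← Finset.sum_div, Finset.sum_neg_distrib]
  congr 2
  ring

/-- Two half-planes of equal mass whose intersections with a vertical half-plane also have
equal mass have boundary lines of equal slope: otherwise the lines cross once, and on one side
of the vertical line one half-plane strictly contains the other. -/
lemma slope_not_lt {m : Measure (ℝ × ℝ)} [IsFiniteMeasure m]
    [m.IsOpenPosMeasure] {h a τ a' τ' : ℝ}
    (hH : m {p | p.2 < a - τ * p.1} = m {p | p.2 < a' - τ' * p.1})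
    (hQ : m {p | p.1 < h ∧ p.2 < a - τ * p.1} = m {p | p.1 < h ∧ p.2 < a' - τ' * p.1}) :
    ¬ τ < τ' := by
  intro hlt
  have key {P Q : Set (ℝ × ℝ)} (hP : MeasurableSet P) (hPQ : P ⊆ Q) (he : m P = m Q)
      {O : Set (ℝ × ℝ)} (hO : IsOpen O) (hne : O.Nonempty) (hOQ : O ⊆ Q \ P) : False := by
    have h0 : m (Q \ P) = 0 := by
      rw [measure_sdiff hPQ hP.nullMeasurableSet (measure_ne_top m P), he, tsub_self]
    exact hO.measure_ne_zero m hne (measure_mono_null hOQ h0)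
  have hm (a τ : ℝ) : MeasurableSet {p : ℝ × ℝ | p.2 < a - τ * p.1} :=
    measurableSet_lt (by fun_prop) (by fun_prop)
  have hmh : MeasurableSet {p : ℝ × ℝ | p.1 < h} := measurableSet_lt (by fun_prop) (by fun_prop)
  obtain ⟨x₀, hx₀⟩ : ∃ x₀, a' - a = (τ' - τ) * x₀ :=
    ⟨(a' - a) / (τ' - τ), by rw [mul_div_cancel₀ _ (sub_pos.2 hlt).ne']⟩
  rcases le_or_gt h x₀ with hle | hgt
  · have hl {x : ℝ} (hx : x < h) : a - τ * x < a' - τ' * x := by nlinarith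
    refine key (hmh.inter (hm a τ)) (Q := {p | p.1 < h ∧ p.2 < a' - τ' * p.1})
      (fun p hp ↦ ⟨hp.1, hp.2.trans (hl hp.1)⟩) hQ
      (O := {p | p.1 < h ∧ a - τ * p.1 < p.2 ∧ p.2 < a' - τ' * p.1}) ?_ ?_ ?_
    · simp only [Set.ofPred_and]
      exact (isOpen_lt (by fun_prop) (by fun_prop)).inter
        ((isOpen_lt (by fun_prop) (by fun_prop)).inter (isOpen_lt (by fun_prop) (by fun_prop)))
    · obtain ⟨y, hy⟩ := exists_between (hl (sub_one_lt h))
      exact ⟨(h - 1, y), sub_one_lt h, hy⟩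
    · exact fun p hp ↦ ⟨⟨hp.1, hp.2.2⟩, fun hq ↦ hq.2.not_gt hp.2.1⟩
  · have hl {x : ℝ} (hx : h ≤ x) : a' - τ' * x < a - τ * x := by nlinarith
    have hcompl : m ({p | p.2 < a' - τ' * p.1} \ {p | p.1 < h}) =
        m ({p | p.2 < a - τ * p.1} \ {p | p.1 < h}) := by
      have e1 := measure_inter_add_sdiff {p | p.2 < a - τ * p.1} hmh (μ := m)
      have e2 := measure_inter_add_sdiff {p | p.2 < a' - τ' * p.1} hmh (μ := m)
      rw [Set.inter_comm] at e1 e2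
      rw [← hH, ← e1] at e2
      refine (ENNReal.add_right_inj (measure_ne_top m _)).1 (e2.trans ?_)
      congr 1
    refine key ((hm a' τ').diff hmh) (Q := {p | p.2 < a - τ * p.1} \ {p | p.1 < h})
      (fun p hp ↦ ⟨lt_trans hp.1 (hl (not_lt.1 hp.2)), hp.2⟩) hcompl
      (O := {p | h < p.1 ∧ a' - τ' * p.1 < p.2 ∧ p.2 < a - τ * p.1}) ?_ ?_ ?_
    · simp only [Set.ofPred_and]
      exact (isOpen_lt (by fun_prop) (by fun_prop)).inter
        ((isOpen_lt (by fun_prop) (by fun_prop)).inter (isOpen_lt (by fun_prop) (by fun_prop)))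
    · obtain ⟨y, hy⟩ := exists_between (hl (lt_add_one h).le)
      exact ⟨(h + 1, y), lt_add_one h, hy⟩
    · exact fun p hp ↦ ⟨⟨hp.2.2, not_lt.2 hp.1.le⟩, fun hq ↦ hq.1.not_gt hp.2.1⟩

instance isOpenPosMeasure_gaussianReal : (gaussianReal 0 1).IsOpenPosMeasure :=
  (gaussianReal_absolutelyContinuous' 0 one_ne_zero).isOpenPosMeasure

lemma gaussianReal_Iio_injective : Function.Injective fun h ↦ gaussianReal 0 1 (Set.Iio h) := by
  refine StrictMono.injective fun h k hhk ↦ ?_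
  refine lt_of_le_of_ne (measure_mono (Set.Iio_subset_Iio hhk.le)) fun he ↦ ?_
  have h0 : gaussianReal 0 1 (Set.Iio k \ Set.Iio h) = 0 := by
    rw [measure_sdiff (Set.Iio_subset_Iio hhk.le) measurableSet_Iio.nullMeasurableSet
      (measure_ne_top _ _), ← he, tsub_self]
  have hsub : Set.Ioo h k ⊆ Set.Iio k \ Set.Iio h := fun x hx ↦ ⟨hx.2, not_lt.2 hx.1.le⟩
  exact isOpen_Ioo.measure_ne_zero (gaussianReal 0 1) (Set.nonempty_Ioo.2 hhk)
    (measure_mono_null hsub h0)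

lemma eq_of_div_sqrt_one_sub_sq_eq {r r' : ℝ} (hr : r ^ 2 < 1) (hr' : r' ^ 2 < 1)
    (h : r / √(1 - r ^ 2) = r' / √(1 - r' ^ 2)) : r = r' := by
  have hs : 0 < √(1 - r ^ 2) := Real.sqrt_pos.2 (by linarith)
  have hs' : 0 < √(1 - r' ^ 2) := Real.sqrt_pos.2 (by linarith)
  have h2 : r ^ 2 = r' ^ 2 := by
    have := congrArg (· ^ 2) h
    simp only [div_pow, Real.sq_sqrt (sub_pos.2 hr).le, Real.sq_sqrt (sub_pos.2 hr').le] at this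
    rw [div_eq_div_iff (by linarith) (by linarith)] at this
    linarith
  rwa [h2, div_left_inj' hs'.ne'] at h

lemma sigmaQ_posDef {n nz : ℕ} (A : Matrix (Fin n) (Fin nz) ℝ)
    {Sz : Matrix (Fin nz) (Fin nz) ℝ} (hp : Sz.PosDef) : (sigmaQ A Sz).PosDef :=
  Matrix.PosDef.one.add_posSemidef
    ((hp.posSemidef.mul_mul_conjTranspose_same A).smul (by positivity))

lemma Matrix.PosDef.sq_apply_lt {n : Type*} {S : Matrix n n ℝ} (hS : S.PosDef) {i j : n}
    (hij : i ≠ j) : S i j ^ 2 < S i i * S j j := by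
  have hinj : Function.Injective ![i, j] := by
    intro a b; fin_cases a <;> fin_cases b <;> simp [hij, hij.symm]
  have := (hS.submatrix hinj).det_pos
  have hsymm : S j i = S i j := by simpa using hS.isHermitian.apply i j
  rw [det_fin_two] at this
  simp [hsymm] at this
  linarith

/-- The masses of the orthants determine the joint law of the signs of the coordinates. -/
lemma mvGaussian_map_neg_ext {n : ℕ} {μ μ' : Fin n → ℝ} {S S' : Matrix (Fin n) (Fin n) ℝ}
    (h : ∀ b, mvGaussian μ S (orthant b) = mvGaussian μ' S' (orthant b))
    (p : (Fin n → Prop) → Prop) :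
    mvGaussian μ S {x | p fun k ↦ x k < 0} = mvGaussian μ' S' {x | p fun k ↦ x k < 0} := by
  classical
  let f : (Fin n → ℝ) → Fin n → Bool := fun x k ↦ decide (x k < 0)
  have hf : Measurable f := measurable_pi_lambda _ fun k ↦
    measurable_to_bool <| by
      have : MeasurableSet {x : Fin n → ℝ | x k < 0} :=
        measurableSet_lt (measurable_pi_apply k) measurable_const
      simpa [Set.preimage, f] using this
  have hfib (μ : Fin n → ℝ) (S : Matrix (Fin n) (Fin n) ℝ) (b : Fin n → Bool) :
      mvGaussian μ S (f ⁻¹' {b}) = mvGaussian μ S (orthant b) := by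
    refine measure_congr ((withDensity_absolutelyContinuous _ _).ae_le ?_)
    have : ∀ᵐ x : Fin n → ℝ, ∀ k, x k ≠ 0 := ae_all_iff.2 fun k ↦ by
      rw [ae_iff]
      simpa [volume_pi] using Measure.pi_hyperplane (fun _ : Fin n ↦ (volume : Measure ℝ)) k 0
    filter_upwards [this] with x hx
    change (f x = b) = (∀ k, if b k then x k < 0 else 0 < x k)
    rw [funext_iff]
    refine propext <| forall_congr' fun k ↦ ?_
    cases b k <;> simp [f, lt_iff_le_and_ne, hx k, (hx k).symm]
  have hmap : (mvGaussian μ S).map f = (mvGaussian μ' S').map f := by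
    refine Measure.ext_of_singleton fun b ↦ ?_
    rw [Measure.map_apply hf (measurableSet_singleton b),
      Measure.map_apply hf (measurableSet_singleton b), hfib, hfib, h]
  have hset : {x : Fin n → ℝ | p fun k ↦ x k < 0} = f ⁻¹' {b | p fun k ↦ b k = true} := by
    ext x; simp [f]
  rw [hset, ← Measure.map_apply hf (Set.toFinite _).measurableSet, hmap,
    Measure.map_apply hf (Set.toFinite _).measurableSet]

open scoped MatrixOrder Matrix.Norms.L2Operator in
lemma mvGaussian_eq_map_multivariateGaussian {n : ℕ} (μ : Fin n → ℝ)
    {S : Matrix (Fin n) (Fin n) ℝ} (hS : S.PosDef) :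
    mvGaussian μ S = (multivariateGaussian 0 S).map fun z ↦ μ + z.ofLp := by
  have hmul : CFC.sqrt S * CFC.sqrt S = S := CFC.sqrt_mul_sqrt_self _ hS.posSemidef.nonneg
  have htr : (CFC.sqrt S)ᵀ = CFC.sqrt S := by
    rw [← conjTranspose_eq_transpose_of_trivial]
    exact (CFC.sqrt_nonneg S).isSelfAdjoint
  have hdet : (CFC.sqrt S).det ≠ 0 := fun h ↦ hS.det_pos.ne' <| by
    rw [← hmul, det_mul, h, zero_mul]
  rw [mvGaussian_eq_map_pi μ hdet (by rw [htr, hmul]), multivariateGaussian,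
    ← map_pi_eq_stdGaussian, Measure.map_map (by fun_prop) (by fun_prop),
    Measure.map_map (by fun_prop) (by fun_prop)]
  congr 1
  ext z k
  simp

/-- A linear change of coordinates turning two coordinates of a Gaussian vector into independent
standard Gaussians. -/
lemma mvGaussian_map_eq_prod {n : ℕ} (μ : Fin n → ℝ) {S : Matrix (Fin n) (Fin n) ℝ}
    (hS : S.PosDef) {i j : Fin n} {α β δ : ℝ} (hi : α ^ 2 * S i i = 1)
    (hij : β * S i j = δ * S i i)
    (hj : β ^ 2 * S j j - 2 * β * δ * S i j + δ ^ 2 * S i i = 1) :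
    (mvGaussian μ S).map
        (fun x ↦ (α * (x i - μ i), β * (x j - μ j) - δ * (x i - μ i))) =
      (gaussianReal 0 1).prod (gaussianReal 0 1) := by
  set P := multivariateGaussian 0 S with hP
  have hL (k : Fin n) : MemLp (fun z : EuclideanSpace ℝ (Fin n) ↦ z k) 2 P :=
    (EuclideanSpace.proj k : EuclideanSpace ℝ (Fin n) →L[ℝ] ℝ).comp_memLp' IsGaussian.memLp_two_id
  have hcov (k l : Fin n) : cov[fun z ↦ z k, fun z ↦ z l; P] = S k l :=
    covariance_eval_multivariateGaussian hS.posSemidef k l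
  have hmean (k : Fin n) : ∫ z, z k ∂P = 0 := by
    have := (EuclideanSpace.proj k : EuclideanSpace ℝ (Fin n) →L[ℝ] ℝ).integral_comp_id_comm
      (μ := P) IsGaussian.integrable_id
    simpa [P] using this
  let X : EuclideanSpace ℝ (Fin n) → ℝ := fun z ↦ α * z i
  let Y : EuclideanSpace ℝ (Fin n) → ℝ := fun z ↦ β * z j - δ * z i
  have hX : Measurable X := by fun_prop
  have hY : Measurable Y := by fun_prop
  let L : EuclideanSpace ℝ (Fin n) →L[ℝ] ℝ × ℝ :=
    (α • EuclideanSpace.proj i).prod (β • EuclideanSpace.proj j - δ • EuclideanSpace.proj i)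
  have hXY : HasGaussianLaw (fun z ↦ (X z, Y z)) P :=
    (IsGaussian.hasGaussianLaw_id (μ := P)).map_fun L
  have hsymm : S j i = S i j := by simpa using hS.isHermitian.apply i j
  have hXYcov : cov[X, Y; P] = 0 := by
    rw [covariance_const_mul_left, covariance_fun_sub_right (hL i) ((hL j).const_mul β)
      ((hL i).const_mul δ), covariance_const_mul_right, covariance_const_mul_right,
      hcov, hcov, hij, sub_self, mul_zero]
  have hXvar : Var[X; P] = 1 := by
    rw [← covariance_self hX.aemeasurable, covariance_const_mul_left,
      covariance_const_mul_right, hcov, ← hi]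
    ring
  have hYvar : Var[Y; P] = 1 := by
    rw [← covariance_self hY.aemeasurable, covariance_fun_sub_fun_sub ((hL j).const_mul β)
      ((hL i).const_mul δ) ((hL j).const_mul β) ((hL i).const_mul δ)]
    simp only [covariance_const_mul_left, covariance_const_mul_right, hcov]
    rw [hsymm, ← hj]
    ring
  have hXmean : ∫ z, X z ∂P = 0 := by
    rw [integral_const_mul, hmean, mul_zero]
  have hYmean : ∫ z, Y z ∂P = 0 := by
    rw [integral_sub (((hL j).integrable one_le_two).const_mul β)
      (((hL i).integrable one_le_two).const_mul δ), integral_const_mul, integral_const_mul,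
      hmean, hmean, mul_zero, mul_zero, sub_zero]
  have hind := hXY.indepFun_of_covariance_eq_zero hXYcov
  rw [indepFun_iff_map_prod_eq_prod_map_map hX.aemeasurable hY.aemeasurable,
    hXY.fst.map_eq_gaussianReal, hXY.snd.map_eq_gaussianReal, hXvar, hYvar, hXmean, hYmean,
    Real.toNNReal_one] at hind
  rw [mvGaussian_eq_map_multivariateGaussian μ hS, Measure.map_map (by fun_prop) (by fun_prop),
    ← hind]
  congr 1
  ext z <;> simp [X, Y]

/-- The negative half-spaces of two coordinates, and their intersection, expressed through a
pair of independent standard Gaussians; the slope of the second half-plane is determined by the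
correlation of the two coordinates. -/
lemma mvGaussian_orthant_eq_prod {n : ℕ} (μ : Fin n → ℝ) {S : Matrix (Fin n) (Fin n) ℝ}
    (hS : S.PosDef) {i j : Fin n} (hr : corrMat S i j ^ 2 < 1) :
    ∃ h a, mvGaussian μ S {x | x i < 0} = gaussianReal 0 1 (Set.Iio h) ∧
      mvGaussian μ S {x | x j < 0} = ((gaussianReal 0 1).prod (gaussianReal 0 1))
        {p | p.2 < a - corrMat S i j / √(1 - corrMat S i j ^ 2) * p.1} ∧
      mvGaussian μ S {x | x i < 0 ∧ x j < 0} = ((gaussianReal 0 1).prod (gaussianReal 0 1))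
        {p | p.1 < h ∧ p.2 < a - corrMat S i j / √(1 - corrMat S i j ^ 2) * p.1} := by
  have hSi : 0 < S i i := hS.diag_pos
  have hSj : 0 < S j j := hS.diag_pos
  have hSij : S i j = corrMat S i j * (√(S i i) * √(S j j)) := by
    rw [corrMat, of_apply, Real.sqrt_mul hSi.le, div_mul_cancel₀ _ (by positivity)]
  have hSi2 : √(S i i) ^ 2 = S i i := Real.sq_sqrt hSi.le
  have hSj2 : √(S j j) ^ 2 = S j j := Real.sq_sqrt hSj.le
  have hs2 := Real.sq_sqrt (sub_pos.2 hr).le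
  have hs : 0 < √(1 - corrMat S i j ^ 2) := Real.sqrt_pos.2 (sub_pos.2 hr)
  have hσ : 0 < √(S i i) := Real.sqrt_pos.2 hSi
  have hσ' : 0 < √(S j j) := Real.sqrt_pos.2 hSj
  generalize corrMat S i j = r at *
  generalize √(S i i) = σ at *
  generalize √(S j j) = σ' at *
  generalize √(1 - r ^ 2) = s at *
  have hmap := mvGaussian_map_eq_prod μ hS (i := i) (j := j) (α := 1 / σ) (β := 1 / (σ' * s))
    (δ := r / (σ * s)) (by rw [← hSi2]; field_simp)
    (by rw [← hSi2, hSij]; field_simp)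
    (by rw [← hSi2, ← hSj2, hSij]; field_simp; rw [hs2]; ring)
  have hmeas : Measurable fun x : Fin n → ℝ ↦
      (1 / σ * (x i - μ i), 1 / (σ' * s) * (x j - μ j) - r / (σ * s) * (x i - μ i)) := by
    fun_prop
  have hi (x : Fin n → ℝ) : 1 / σ * (x i - μ i) < -(μ i / σ) ↔ x i < 0 := by
    rw [← sub_neg, show 1 / σ * (x i - μ i) - -(μ i / σ) = x i / σ by ring, div_neg_iff]
    simp [hσ, hσ.not_gt]
  have hj (x : Fin n → ℝ) :
      1 / (σ' * s) * (x j - μ j) - r / (σ * s) * (x i - μ i) <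
        -(μ j / (σ' * s)) - r / s * (1 / σ * (x i - μ i)) ↔ x j < 0 := by
    rw [← sub_neg, show 1 / (σ' * s) * (x j - μ j) - r / (σ * s) * (x i - μ i) -
      (-(μ j / (σ' * s)) - r / s * (1 / σ * (x i - μ i))) = x j / (σ' * s) by
        field_simp; ring, div_neg_iff]
    have := mul_pos hσ' hs
    simp [this, this.not_gt]
  have hm1 : MeasurableSet {p : ℝ × ℝ | p.1 < -(μ i / σ)} :=
    measurableSet_lt (by fun_prop) (by fun_prop)
  have hm2 : MeasurableSet {p : ℝ × ℝ | p.2 < -(μ j / (σ' * s)) - r / s * p.1} :=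
    measurableSet_lt (by fun_prop) (by fun_prop)
  refine ⟨-(μ i / σ), -(μ j / (σ' * s)), ?_, ?_, ?_⟩
  · have hprod : gaussianReal 0 1 (Set.Iio (-(μ i / σ))) =
        ((gaussianReal 0 1).prod (gaussianReal 0 1)) {p | p.1 < -(μ i / σ)} := by
      rw [show {p : ℝ × ℝ | p.1 < -(μ i / σ)} = Set.Iio (-(μ i / σ)) ×ˢ Set.univ by ext; simp,
        Measure.prod_prod, measure_univ, mul_one]
    rw [hprod, ← hmap, Measure.map_apply hmeas hm1]
    simp only [Set.preimage_ofPred_eq, hi]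
  · rw [← hmap, Measure.map_apply hmeas hm2]
    simp only [Set.preimage_ofPred_eq, hj]
  · rw [← hmap, Set.ofPred_and (p := fun p : ℝ × ℝ ↦ p.1 < -(μ i / σ)),
      Measure.map_apply hmeas (hm1.inter hm2), Set.preimage_inter, Set.ofPred_and]
    simp only [Set.preimage_ofPred_eq, hi, hj]

lemma corrMat_apply_self {n : ℕ} {S : Matrix (Fin n) (Fin n) ℝ} (hS : S.PosDef) (i : Fin n) :
    corrMat S i i = 1 := by
  rw [corrMat, of_apply, Real.sqrt_mul_self hS.diag_pos.le, div_self hS.diag_pos.ne']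

lemma corrMat_sq_lt_one {n : ℕ} {S : Matrix (Fin n) (Fin n) ℝ} (hS : S.PosDef) {i j : Fin n}
    (hij : i ≠ j) : corrMat S i j ^ 2 < 1 := by
  have hpos : 0 < S i i * S j j := mul_pos hS.diag_pos hS.diag_pos
  rw [corrMat, of_apply, div_pow, Real.sq_sqrt hpos.le, div_lt_one hpos]
  exact hS.sq_apply_lt hij

/-- **Corollary 1.** The correlation matrix of `Σ_q` in a given segment is identifiable
from the binary distribution: if two binary ICA models induce the same distribution
on the binary observations, the correlation matrices of their `Σ_q` coincide. -/
theorem corr_identifiable_from_binary_distribution {n nz nz' : ℕ}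
    (A : Matrix (Fin n) (Fin nz) ℝ) (hA : LinearIndependent ℝ fun j i => A i j)
    (μz : Fin nz → ℝ) (Sz : Matrix (Fin nz) (Fin nz) ℝ)
    (hd : Sz.IsDiag) (hp : Sz.PosDef)
    (A' : Matrix (Fin n) (Fin nz') ℝ) (hA' : LinearIndependent ℝ fun j i => A' i j)
    (μz' : Fin nz' → ℝ) (Sz' : Matrix (Fin nz') (Fin nz') ℝ)
    (hd' : Sz'.IsDiag) (hp' : Sz'.PosDef)
    (hsame : ∀ b : Fin n → Bool, binProb A μz Sz b = binProb A' μz' Sz' b) :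
    corrMat (sigmaQ A Sz) = corrMat (sigmaQ A' Sz') := by
  have hS := sigmaQ_posDef A hp
  have hS' := sigmaQ_posDef A' hp'
  ext i j
  rcases eq_or_ne i j with rfl | hij
  · rw [corrMat_apply_self hS, corrMat_apply_self hS']
  have hr := corrMat_sq_lt_one hS hij
  have hr' := corrMat_sq_lt_one hS' hij
  obtain ⟨h, a, hi, hj, hQ⟩ := mvGaussian_orthant_eq_prod (muQ A μz) hS hr
  obtain ⟨h', a', hi', hj', hQ'⟩ := mvGaussian_orthant_eq_prod (muQ A' μz') hS' hr'
  rw [mvGaussian_map_neg_ext hsame fun b ↦ b i, hi'] at hi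
  rw [mvGaussian_map_neg_ext hsame fun b ↦ b j, hj'] at hj
  rw [mvGaussian_map_neg_ext hsame fun b ↦ b i ∧ b j, hQ'] at hQ
  obtain rfl := gaussianReal_Iio_injective hi
  exact eq_of_div_sqrt_one_sub_sq_eq hr hr' <|
    le_antisymm (not_lt.1 (slope_not_lt hj hQ)) (not_lt.1 (slope_not_lt hj.symm hQ.symm))
end

section
/- Let A be a real n×n_z matrix, μ_z ∈ ℝ^{n_z}, Σ_z a diagonal positive-definite n_z×n_z matrix, and b ∈ {0,1}^n any binary assignment. Let y ~ N(Aμ_z, AΣ_zAᵀ) and, conditionally on y, let each x_i ∈ {0,1} independently equal 1 with probability Φ(√(π/8) y_i). Then P(x = b) equals the probability, under the Gaussian measure N(μ_q, Σ_q) with μ_q = −√(π/8) A μ_z and Σ_q = I_n + (π/8) A Σ_z Aᵀ, of the orthant {w ∈ ℝ^n : w_i < 0 whenever b_i = 1, and w_i > 0 whenever b_i = 0}. -/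
open MeasureTheory Matrix Real

open ProbabilityTheory
open scoped MatrixOrder

/-- The law of `n` independent standard normal variables. -/
noncomputable abbrev stdGaussianPi (n : ℕ) : Measure (Fin n → ℝ) :=
  Measure.pi fun _ => gaussianReal 0 1

lemma prod_gaussianPDFReal_zero_one {n : ℕ} (x : Fin n → ℝ) :
    ∏ i, gaussianPDFReal 0 1 (x i) =
      (Real.sqrt ((2 * Real.pi) ^ n))⁻¹ * Real.exp (-(1 / 2) * (x ⬝ᵥ x)) := by
  simp only [gaussianPDFReal, Finset.prod_mul_distrib, ← Real.exp_sum]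
  congr 1
  · simp only [NNReal.coe_one, mul_one, Finset.prod_const, Finset.card_univ, Fintype.card_fin,
      inv_pow]
    rw [_root_.inv_inj, eq_comm, Real.sqrt_eq_iff_mul_self_eq (by positivity) (by positivity), ← mul_pow,
      Real.mul_self_sqrt (by positivity)]
  · congr 1
    rw [dotProduct, Finset.mul_sum]
    refine Finset.sum_congr rfl fun i _ => ?_
    simp only [NNReal.coe_one, sub_zero]
    ring

lemma stdGaussianPi_eq_withDensity (n : ℕ) :
    stdGaussianPi n = volume.withDensity fun x =>
      ENNReal.ofReal (∏ i, gaussianPDFReal 0 1 (x i)) := by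
  refine Measure.pi_eq fun s hs => ?_
  rw [withDensity_apply _ (MeasurableSet.univ_pi hs), volume_pi, Measure.restrict_pi_pi,
    ← ofReal_integral_eq_lintegral_ofReal, integral_fintype_prod_eq_prod,
    ENNReal.ofReal_prod_of_nonneg]
  · simp_rw [gaussianReal_apply_eq_integral 0 one_ne_zero]
  · exact fun i _ => integral_nonneg fun x => gaussianPDFReal_nonneg 0 1 x
  · exact Integrable.fintype_prod fun i => (integrable_gaussianPDFReal 0 1).restrict
  · exact Filter.Eventually.of_forall fun x =>
      Finset.prod_nonneg fun i _ => gaussianPDFReal_nonneg 0 1 (x i)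

lemma mulVec_dotProduct_inv_mul_transpose {n : ℕ} {B : Matrix (Fin n) (Fin n) ℝ}
    (hB : B.det ≠ 0) (x : Fin n → ℝ) :
    (B *ᵥ x) ⬝ᵥ ((B * Bᵀ)⁻¹ *ᵥ (B *ᵥ x)) = x ⬝ᵥ x := by
  have hu : IsUnit B.det := isUnit_iff_ne_zero.2 hB
  have hut : IsUnit Bᵀ.det := by rwa [det_transpose]
  rw [mulVec_mulVec, Matrix.mul_inv_rev, Matrix.mul_assoc, nonsing_inv_mul _ hu, Matrix.mul_one,
    ← vecMul_transpose, ← dotProduct_mulVec, mulVec_mulVec, mul_nonsing_inv _ hut, one_mulVec]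

/-- A nondegenerate Gaussian is an affine image of a standard one. -/
lemma mvGaussian_mul_transpose {n : ℕ} (μ : Fin n → ℝ) {B : Matrix (Fin n) (Fin n) ℝ}
    (hB : B.det ≠ 0) :
    mvGaussian μ (B * Bᵀ) = (stdGaussianPi n).map fun x => μ + B *ᵥ x := by
  have hm : Measurable fun x : Fin n → ℝ => B *ᵥ x :=
    (Continuous.matrix_mulVec continuous_const continuous_id).measurable
  have hmap : (volume : Measure (Fin n → ℝ)).map (fun x => μ + B *ᵥ x) =
      ENNReal.ofReal |B.det⁻¹| • volume := by
    have h := Real.map_matrix_volume_pi_eq_smul_volume_pi hB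
    have : (fun x : Fin n → ℝ => μ + B *ᵥ x) = (μ + ·) ∘ toLin' B := by
      ext x; simp
    rw [this, ← Measure.map_map (by fun_prop) (by simpa only [← toLin'_apply] using hm), h, Measure.map_smul,
      map_add_left_eq_self]
  have hvol : (volume : Measure (Fin n → ℝ)) =
      ENNReal.ofReal |B.det| • volume.map (fun x => μ + B *ᵥ x) := by
    rw [hmap, smul_smul, ← ENNReal.ofReal_mul (abs_nonneg _), ← abs_mul, mul_inv_cancel₀ hB]
    simp
  have hmeas : Measurable fun x : Fin n → ℝ =>
      ENNReal.ofReal (Real.sqrt (((2 * Real.pi) ^ n * (B * Bᵀ).det)⁻¹) *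
        Real.exp (-(1 / 2) * ((x - μ) ⬝ᵥ ((B * Bᵀ)⁻¹ *ᵥ (x - μ))))) := by
    refine (Continuous.measurable ?_).ennreal_ofReal
    fun_prop
  ext s hs
  rw [Measure.map_apply (by fun_prop) hs, stdGaussianPi_eq_withDensity, mvGaussian,
    withDensity_apply _ hs, withDensity_apply _ ((by fun_prop : Measurable _) hs), hvol,
    Measure.restrict_smul, lintegral_smul_measure, setLIntegral_map hs hmeas (by fun_prop),
    smul_eq_mul, ← lintegral_const_mul _ (by fun_prop), ← hvol]
  refine lintegral_congr fun x => ?_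
  rw [← ENNReal.ofReal_mul (abs_nonneg _), add_sub_cancel_left,
    mulVec_dotProduct_inv_mul_transpose hB, prod_gaussianPDFReal_zero_one, ← mul_assoc, det_mul,
    det_transpose, ← sq, Real.sqrt_inv, Real.sqrt_mul (by positivity), Real.sqrt_sq_eq_abs]
  congr 2
  have : |B.det| ≠ 0 := abs_ne_zero.2 hB
  field_simp

/-- Every positive definite real matrix has an invertible square root `B * Bᵀ`. -/
lemma Matrix.PosDef.exists_eq_mul_transpose {n : ℕ} {S : Matrix (Fin n) (Fin n) ℝ}
    (hS : S.PosDef) : ∃ B : Matrix (Fin n) (Fin n) ℝ, B.det ≠ 0 ∧ S = B * Bᵀ := by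
  obtain ⟨y, hy, rfl⟩ := CStarAlgebra.isStrictlyPositive_iff_eq_star_mul_self.mp
    hS.isStrictlyPositive
  refine ⟨yᵀ, ?_, ?_⟩
  · rw [det_transpose]
    exact ((isUnit_iff_isUnit_det y).1 hy).ne_zero
  · rw [transpose_transpose, star_eq_conjTranspose, conjTranspose_eq_transpose_of_trivial]

lemma charFunDual_stdGaussianPi {n : ℕ} (L : StrongDual ℝ (Fin n → ℝ)) :
    charFunDual (stdGaussianPi n) L =
      Complex.exp (-(∑ i, L (Pi.single i 1) ^ 2 : ℝ) / 2) := by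
  rw [charFunDual_pi]
  simp only [charFunDual_eq_charFun_map_one]
  have h : ∀ i, ⇑(L.comp (ContinuousLinearMap.single ℝ (fun _ : Fin n => ℝ) i)) =
      (L (Pi.single i 1) * ·) := by
    intro i
    ext x
    have : Pi.single i x = x • (Pi.single i 1 : Fin n → ℝ) := by
      rw [← Pi.single_smul, smul_eq_mul, mul_one]
    simp [this, mul_comm]
  simp only [h, gaussianReal_map_const_mul, charFun_gaussianReal, ← Complex.exp_sum]
  congr 1
  simp [Finset.sum_div, neg_div]

lemma strongDual_comp_mulVec_sum_sq {n k : ℕ} (L : StrongDual ℝ (Fin n → ℝ))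
    (M : Matrix (Fin n) (Fin k) ℝ) :
    ∑ j, L (M *ᵥ Pi.single j 1) ^ 2 =
      (fun i => L (Pi.single i 1)) ⬝ᵥ ((M * Mᵀ) *ᵥ fun i => L (Pi.single i 1)) := by
  have hL : ∀ v : Fin n → ℝ, L v = (fun i => L (Pi.single i 1)) ⬝ᵥ v := by
    intro v
    conv_lhs => rw [pi_eq_sum_univ' v]
    simp [dotProduct, mul_comm]
  rw [← mulVec_mulVec, dotProduct_mulVec, mulVec_transpose, dotProduct]
  refine Finset.sum_congr rfl fun j _ => ?_
  rw [hL, dotProduct_mulVec, dotProduct_single, mul_one, sq]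

/-- The law of an affine image of a standard Gaussian depends only on the mean and the
covariance. -/
lemma map_prod_stdGaussianPi {n k : ℕ} (μ : Fin n → ℝ) (M : Matrix (Fin n) (Fin k) ℝ)
    (C : Matrix (Fin n) (Fin n) ℝ) (hC : C * Cᵀ = 1 + M * Mᵀ) :
    ((stdGaussianPi n).prod (stdGaussianPi k)).map (fun p => μ + (p.1 + M *ᵥ p.2)) =
      (stdGaussianPi n).map fun x => μ + C *ᵥ x := by
  let F : (Fin n → ℝ) × (Fin k → ℝ) →L[ℝ] (Fin n → ℝ) :=
    (ContinuousLinearMap.id ℝ _).coprod (toLin' M).toContinuousLinearMap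
  let G : (Fin n → ℝ) →L[ℝ] (Fin n → ℝ) := (toLin' C).toContinuousLinearMap
  have hF : (fun p : (Fin n → ℝ) × (Fin k → ℝ) => μ + (p.1 + M *ᵥ p.2)) = (μ + ·) ∘ F := by
    ext p; simp [F]
  have hG : (fun x : Fin n → ℝ => μ + C *ᵥ x) = (μ + ·) ∘ G := by
    ext p; simp [G]
  rw [hF, hG, ← Measure.map_map (by fun_prop) (by fun_prop),
    ← Measure.map_map (by fun_prop) (by fun_prop)]
  congr 1
  refine Measure.ext_of_charFunDual (funext fun L => ?_)
  rw [charFunDual_map, charFunDual_map, charFunDual_prod, charFunDual_stdGaussianPi,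
    charFunDual_stdGaussianPi, charFunDual_stdGaussianPi, ← Complex.exp_add]
  congr 1
  have h1 := strongDual_comp_mulVec_sum_sq L M
  have h2 := strongDual_comp_mulVec_sum_sq L C
  have h3 := strongDual_comp_mulVec_sum_sq L (1 : Matrix (Fin n) (Fin n) ℝ)
  rw [hC, add_mulVec, dotProduct_add] at h2
  simp only [one_mulVec, Matrix.one_mul, transpose_one] at h2 h3
  rw [← h1, ← h3] at h2
  simp only [F, G, ContinuousLinearMap.comp_apply, LinearMap.coe_toContinuousLinearMap',
    toLin'_apply, ContinuousLinearMap.inl_apply, ContinuousLinearMap.inr_apply,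
    ContinuousLinearMap.coprod_apply, ContinuousLinearMap.id_apply, mulVec_zero, add_zero,
    zero_add]
  rw [h2]
  push_cast
  ring

lemma gaussianReal_Iic_toReal (t : ℝ) :
    (gaussianReal 0 1 (Set.Iic t)).toReal = stdNormalCDF t := by
  rw [gaussianReal_apply_eq_integral 0 one_ne_zero,
    ENNReal.toReal_ofReal (integral_nonneg fun x => gaussianPDFReal_nonneg 0 1 x), stdNormalCDF]
  simp [gaussianPDFReal]

/-- The law of a standard Gaussian vector translated by `-v` gives the orthant of `b` the product
of the one-dimensional probabilities. -/
lemma stdGaussianPi_preimage_orthant {n : ℕ} (b : Fin n → Bool) (v : Fin n → ℝ) :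
    (stdGaussianPi n {x | x - v ∈ orthant b}).toReal =
      ∏ i, if b i then stdNormalCDF (v i) else 1 - stdNormalCDF (v i) := by
  have : {x | x - v ∈ orthant b} =
      Set.univ.pi fun i => if b i then Set.Iio (v i) else Set.Ioi (v i) := by
    ext x
    simp only [orthant, Set.mem_ofPred_eq, Set.mem_univ_pi, Pi.sub_apply]
    refine forall_congr' fun i => ?_
    split_ifs <;> simp
  rw [this, Measure.pi_pi, ENNReal.toReal_prod]
  refine Finset.prod_congr rfl fun i _ => ?_
  have := nullSingletonClass_gaussianReal (μ := 0) (one_ne_zero : (1 : NNReal) ≠ 0)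
  split_ifs
  · rw [← gaussianReal_Iic_toReal, measure_congr Iio_ae_eq_Iic]
  · rw [← gaussianReal_Iic_toReal, ← Set.compl_Iic]
    exact probReal_compl_eq_one_sub measurableSet_Iic

lemma measurableSet_orthant {n : ℕ} (b : Fin n → Bool) : MeasurableSet (orthant b) := by
  simp only [orthant, Set.ofPred_forall]
  refine MeasurableSet.iInter fun i => ?_
  split_ifs
  · exact measurableSet_lt (measurable_pi_apply i) measurable_const
  · exact measurableSet_lt measurable_const (measurable_pi_apply i)

/-- **Probability of a general binary assignment.** With `y = A z` for
`z ~ N(μ_z, Σ_z)` (so `y ~ N(A μ_z, A Σ_z Aᵀ)`), and, conditionally on `y`, each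
`x_i ∈ {0,1}` independently equal to `1` with probability `Φ(√(π/8) y_i)`, the
probability `P(x = b)` equals the probability of the orthant determined by `b` under
`N(μ_q, Σ_q)` with `μ_q = −√(π/8) A μ_z` and `Σ_q = I + (π/8) A Σ_z Aᵀ`. -/
theorem prob_binary_assignment {n nz : ℕ} (A : Matrix (Fin n) (Fin nz) ℝ)
    (μz : Fin nz → ℝ) (Sz : Matrix (Fin nz) (Fin nz) ℝ)
    (hd : Sz.IsDiag) (hp : Sz.PosDef) (b : Fin n → Bool) :
    (∫ y, ∏ i, (if b i then stdNormalCDF (Real.sqrt (Real.pi / 8) * y i)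
          else 1 - stdNormalCDF (Real.sqrt (Real.pi / 8) * y i))
        ∂(Measure.map (fun z => A *ᵥ z) (mvGaussian μz Sz)))
      = (mvGaussian ((-Real.sqrt (Real.pi / 8)) • (A *ᵥ μz))
          ((1 : Matrix (Fin n) (Fin n) ℝ) + (Real.pi / 8) • (A * Sz * Aᵀ))
          (orthant b)).toReal := by
  obtain ⟨B, hB, hS⟩ := hp.exists_eq_mul_transpose
  set c := Real.sqrt (Real.pi / 8) with hc
  have hc2 : c * c = Real.pi / 8 := Real.mul_self_sqrt (by positivity)
  have hcov : (1 : Matrix (Fin n) (Fin n) ℝ) + (Real.pi / 8) • (A * Sz * Aᵀ) =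
      1 + ((-c) • (A * B)) * ((-c) • (A * B))ᵀ := by
    rw [hS, ← hc2, transpose_smul, transpose_mul, Matrix.smul_mul, Matrix.mul_smul, smul_smul,
      neg_mul_neg]
    simp only [Matrix.mul_assoc]
  have hpos : ((1 : Matrix (Fin n) (Fin n) ℝ) + (Real.pi / 8) • (A * Sz * Aᵀ)).PosDef := by
    rw [hcov]
    refine PosDef.one.add_posSemidef ?_
    simpa only [conjTranspose_eq_transpose_of_trivial] using
      posSemidef_self_mul_conjTranspose ((-c) • (A * B))
  obtain ⟨C, hC, hCC⟩ := hpos.exists_eq_mul_transpose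
  have hmeasA : Measurable fun z : Fin nz → ℝ => A *ᵥ z := by fun_prop
  rw [hCC, mvGaussian_mul_transpose _ hC, ← map_prod_stdGaussianPi _ ((-c) • (A * B)) C
    (hCC.symm.trans hcov), hS, mvGaussian_mul_transpose _ hB,
    Measure.map_map hmeasA (by fun_prop)]
  have hmap : Measurable fun p : (Fin n → ℝ) × (Fin nz → ℝ) =>
      (-c) • (A *ᵥ μz) + (p.1 + ((-c) • (A * B)) *ᵥ p.2) := by fun_prop
  have horth : Measurable fun y : Fin n → ℝ =>
      (stdGaussianPi n {x | x - c • y ∈ orthant b}).toReal := by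
    have hs : MeasurableSet {p : (Fin n → ℝ) × (Fin n → ℝ) | p.2 - c • p.1 ∈ orthant b} :=
      (by fun_prop : Measurable fun p : (Fin n → ℝ) × (Fin n → ℝ) => p.2 - c • p.1)
        (measurableSet_orthant b)
    exact (measurable_measure_prodMk_left hs).ennreal_toReal
  have hprod : ∀ y : Fin n → ℝ,
      (∏ i, if b i then stdNormalCDF (c * y i) else 1 - stdNormalCDF (c * y i)) =
        (stdGaussianPi n {x | x - c • y ∈ orthant b}).toReal := fun y =>
    (stdGaussianPi_preimage_orthant b (c • y)).symm
  have hset : ∀ u : Fin nz → ℝ,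
      (fun x => (x, u)) ⁻¹' ((fun p : (Fin n → ℝ) × (Fin nz → ℝ) =>
        (-c) • (A *ᵥ μz) + (p.1 + ((-c) • (A * B)) *ᵥ p.2)) ⁻¹' orthant b) =
      {x | x - c • (A *ᵥ (μz + B *ᵥ u)) ∈ orthant b} := by
    intro u
    ext x
    have : (-c) • (A *ᵥ μz) + (x + ((-c) • (A * B)) *ᵥ u) = x - c • (A *ᵥ (μz + B *ᵥ u)) := by
      rw [smul_mulVec, ← mulVec_mulVec, mulVec_add, smul_add, neg_smul, neg_smul]
      abel
    simp only [Set.mem_preimage, this, Set.mem_ofPred_eq]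
  simp_rw [hprod]
  rw [integral_map (hmeasA.comp (by fun_prop)).aemeasurable horth.aestronglyMeasurable,
    Measure.map_apply hmap (measurableSet_orthant b),
    Measure.prod_apply_symm (hmap (measurableSet_orthant b))]
  simp_rw [hset]
  rw [← integral_toReal]
  · rfl
  · simp_rw [← hset]
    exact (measurable_measure_prodMk_right (hmap (measurableSet_orthant b))).aemeasurable
  · exact Filter.Eventually.of_forall fun u => measure_lt_top _ _
end
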